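/- Let L_DSM(s) := (1/2) E_{t∼U(0,T)} E_{(x₀,y)∼q} E_{x_t∼k_t(·|x₀)} [λ(t) ‖∇_{x_t} ln k_t(x_t|x₀) − s(x_t,y,t)‖²] and L_COND(s) := (1/2) E_{t∼U(0,T)} E_{(x_t,y)∼p_t} [λ(t) ‖∇_{x_t} ln p_t(x_t|y) − s(x_t,y,t)‖²]. Then there exists a constant C, not depending on s, such that L_DSM(s) = L_COND(s) + C for every measurable s : ℝⁿ × ℝᵐ × [0,T] → ℝⁿ for which both losses are finite. Consequently, over any family of such functions, the minimizers of L_DSM coincide with the minimizers of L_COND. -/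

import Mathlib

open MeasureTheory

noncomputable section

/-- `ℝⁿ` as a Euclidean space. -/
abbrev Euc (n : ℕ) := EuclideanSpace ℝ (Fin n)

/-- Score `∇ ln f` of a positive function `f`. -/
def scoreOf {n : ℕ} (f : Euc n → ℝ) (x : Euc n) : Euc n :=
  gradient (fun u => Real.log (f u)) x

/-- The base measure for the denoising loss: `t` ranges uniformly over `(0,T]` (up to the
normalizing factor `1/T`, included in the loss below), `(x₀,y)` and `x_t` over Lebesgue
measure. -/
def dsmMeas (n m : ℕ) (T : ℝ) : Measure (ℝ × (Euc n × Euc m) × Euc n) :=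
  (volume.restrict (Set.Ioc (0 : ℝ) T)).prod volume

/-- The base measure for the conditional loss: `t` ranges over `(0,T]`, `(x_t,y)` over
Lebesgue measure. -/
def condMeas (n m : ℕ) (T : ℝ) : Measure (ℝ × Euc n × Euc m) :=
  (volume.restrict (Set.Ioc (0 : ℝ) T)).prod volume

/-- Integrand of the denoising loss `L_DSM` at `z = (t, (x₀,y), x_t)`:
`q(x₀,y) · k_t(x_t|x₀) · λ(t) ‖∇_{x_t} ln k_t(x_t|x₀) − s(x_t,y,t)‖²`. -/
def dsmIntegrand (n m : ℕ) (q : Euc n × Euc m → ℝ) (k : ℝ → Euc n → Euc n → ℝ)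
    (lam : ℝ → ℝ) (s : Euc n → Euc m → ℝ → Euc n)
    (z : ℝ × (Euc n × Euc m) × Euc n) : ℝ :=
  q z.2.1 * k z.1 z.2.2 z.2.1.1 *
    (lam z.1 * ‖scoreOf (fun u => k z.1 u z.2.1.1) z.2.2 - s z.2.2 z.2.1.2 z.1‖ ^ 2)

/-- Integrand of the conditional loss `L_COND` at `w = (t, x_t, y)`:
`p_t(x_t,y) · λ(t) ‖∇_{x_t} ln p_t(x_t|y) − s(x_t,y,t)‖²`. -/
def condIntegrand (n m : ℕ) (pt : ℝ → Euc n × Euc m → ℝ) (ptc : ℝ → Euc n → Euc m → ℝ)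
    (lam : ℝ → ℝ) (s : Euc n → Euc m → ℝ → Euc n)
    (w : ℝ × Euc n × Euc m) : ℝ :=
  pt w.1 (w.2.1, w.2.2) *
    (lam w.1 * ‖scoreOf (fun u => ptc w.1 u w.2.2) w.2.1 - s w.2.1 w.2.2 w.1‖ ^ 2)

/-- `L_DSM(s) = (1/2) E_{t∼U(0,T)} E_{(x₀,y)∼q} E_{x_t∼k_t(·|x₀)}
[λ(t)‖∇ ln k_t(x_t|x₀) − s(x_t,y,t)‖²]`. -/
def LDSM (n m : ℕ) (T : ℝ) (q : Euc n × Euc m → ℝ) (k : ℝ → Euc n → Euc n → ℝ)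
    (lam : ℝ → ℝ) (s : Euc n → Euc m → ℝ → Euc n) : ℝ :=
  (1 / 2) * (T⁻¹ * ∫ z, dsmIntegrand n m q k lam s z ∂dsmMeas n m T)

/-- `L_COND(s) = (1/2) E_{t∼U(0,T)} E_{(x_t,y)∼p_t}[λ(t)‖∇ ln p_t(x_t|y) − s(x_t,y,t)‖²]`. -/
def LCOND (n m : ℕ) (T : ℝ) (pt : ℝ → Euc n × Euc m → ℝ) (ptc : ℝ → Euc n → Euc m → ℝ)
    (lam : ℝ → ℝ) (s : Euc n → Euc m → ℝ → Euc n) : ℝ :=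
  (1 / 2) * (T⁻¹ * ∫ w, condIntegrand n m pt ptc lam s w ∂condMeas n m T)

lemma aux_meas_fderiv {n : ℕ} (k : Euc n → Euc n → ℝ)
    (hk_meas : Measurable fun z : Euc n × Euc n => k z.1 z.2)
    (hk_diff : ∀ x₀, ContDiff ℝ 1 fun x => k x x₀) (e : Euc n) :
    Measurable fun z : Euc n × Euc n => fderiv ℝ (fun x => k x z.2) z.1 e := by
  refine measurable_of_tendsto_metrizable
    (f := fun (N : ℕ) (z : Euc n × Euc n) =>
      ((N : ℝ) + 1) * (k (z.1 + ((N : ℝ) + 1)⁻¹ • e) z.2 - k z.1 z.2)) ?_ ?_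
  · intro N
    have h1 : Measurable fun z : Euc n × Euc n => (z.1 + ((N : ℝ) + 1)⁻¹ • e, z.2) := by fun_prop
    exact ((hk_meas.comp h1).sub hk_meas).const_mul _
  · rw [tendsto_pi_nhds]
    rintro ⟨x, x₀⟩
    have hd : HasFDerivAt (fun x => k x x₀) (fderiv ℝ (fun x => k x x₀) x) x :=
      ((hk_diff x₀).differentiable (by norm_num) x).hasFDerivAt
    have := hd.lim e (c := fun N : ℕ => (N : ℝ) + 1) (l := Filter.atTop) ?_
    · simpa using this
    · have h2 : Filter.Tendsto (fun N : ℕ => (N : ℝ) + 1) Filter.atTop Filter.atTop :=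
        Filter.tendsto_atTop_add_const_right _ _ tendsto_natCast_atTop_atTop
      exact tendsto_norm_atTop_atTop.comp h2

lemma aux_key {n : ℕ} (q : Euc n → ℝ) (hq : Measurable q) (k : Euc n → Euc n → ℝ)
    (hk_meas : Measurable fun z : Euc n × Euc n => k z.1 z.2)
    (hk_diff : ∀ x₀, ContDiff ℝ 1 fun x => k x x₀) (e : Euc n)
    (hH : Integrable (fun z : Euc n × Euc n => q z.2 * fderiv ℝ (fun x => k x z.2) z.1 e)
      (volume.prod volume))
    (hint : ∀ x, Integrable fun x₀ => q x₀ * k x x₀)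
    (p : Euc n → ℝ) (hp : ∀ x, p x = ∫ x₀, q x₀ * k x x₀) (hpd : Differentiable ℝ p) :
    ∀ᵐ x, ∫ x₀, q x₀ * fderiv ℝ (fun x => k x x₀) x e = fderiv ℝ p x e := by
  set H : Euc n × Euc n → ℝ := fun z => q z.2 * fderiv ℝ (fun x => k x z.2) z.1 e with hHdef
  have hHm : Measurable H := (hq.comp measurable_snd).mul (aux_meas_fderiv k hk_meas hk_diff e)
  set F : Euc n → ℝ := fun x => ∫ x₀, H (x, x₀) with hF
  have hFm : Measurable F := (hHm.stronglyMeasurable.integral_prod_right').measurable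
  have hGm : Measurable fun x => fderiv ℝ p x e := measurable_fderiv_apply_const ℝ p e
  have hNm : MeasurableSet {x | F x = fderiv ℝ p x e} := measurableSet_eq_fun hFm hGm
  let μ : Measure ℝ := volume.restrict (Set.Ioc (0:ℝ) 1)
  -- integrability of the translated function
  have h1 : Integrable (fun w : ℝ × (Euc n × Euc n) => H (w.2.1 + w.1 • e, w.2.2))
      (μ.prod (volume.prod volume)) := by
    have hm : Measurable (fun w : ℝ × (Euc n × Euc n) => H (w.2.1 + w.1 • e, w.2.2)) := by
      apply hHm.comp; fun_prop
    have mp : ∀ r : ℝ, MeasurePreserving (fun z : Euc n × Euc n => (z.1 + r • e, z.2))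
        (volume.prod volume) (volume.prod volume) := fun r =>
      (measurePreserving_add_right (volume : Measure (Euc n)) (r • e)).prod
        (MeasurePreserving.id (volume : Measure (Euc n)))
    rw [integrable_prod_iff hm.aestronglyMeasurable]
    refine ⟨Filter.Eventually.of_forall fun r => (mp r).integrable_comp_of_integrable hH, ?_⟩
    have : (fun r : ℝ => ∫ z : Euc n × Euc n, ‖H (z.1 + r • e, z.2)‖ ∂(volume.prod volume))
        = fun _ => ∫ z, ‖H z‖ ∂(volume.prod volume) := by
      funext r
      have h := integral_map (μ := volume.prod volume) (mp r).measurable.aemeasurable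
        (f := fun z => ‖H z‖) hHm.norm.aestronglyMeasurable
      rw [(mp r).map_eq] at h
      exact h.symm
    rw [this]
    exact integrable_const _
  have h2 : ∀ᵐ x, Integrable (fun w : ℝ × Euc n => H (x + w.1 • e, w.2)) (μ.prod volume) := by
    have mp : MeasurePreserving
        (fun w : Euc n × (ℝ × Euc n) => (w.2.1, (w.1, w.2.2)))
        ((volume : Measure (Euc n)).prod (μ.prod volume)) (μ.prod (volume.prod volume)) := by
      have a := (measurePreserving_prodAssoc (volume : Measure (Euc n)) μ (volume : Measure (Euc n))).symm
      have b := (Measure.measurePreserving_swap (μ := (volume : Measure (Euc n))) (ν := μ)).prod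
        (MeasurePreserving.id (volume : Measure (Euc n)))
      have c := measurePreserving_prodAssoc μ (volume : Measure (Euc n)) (volume : Measure (Euc n))
      exact c.comp (b.comp a)
    have := (mp.integrable_comp_of_integrable h1).prod_right_ae
    filter_upwards [this] with x hx
    simpa [Function.comp_def] using hx
  have h3 : ∀ᵐ x, ∀ᵐ r ∂μ, F (x + r • e) = fderiv ℝ p (x + r • e) e := by
    filter_upwards [h2] with x hx
    have hFi : IntervalIntegrable (fun r : ℝ => F (x + r • e)) volume 0 1 := by
      rw [intervalIntegrable_iff_integrableOn_Ioc_of_le zero_le_one]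
      exact hx.integral_prod_left
    have hftc : ∀ h ∈ Set.Ioc (0:ℝ) 1, ∫ r in (0:ℝ)..h, F (x + r • e) = p (x + h • e) - p x := by
      intro h hh
      have := intervalIntegral_integral_swap (a := 0) (b := h) (μ := (volume : Measure (Euc n)))
        (f := fun r x₀ => H (x + r • e, x₀)) ?_
      · rw [this, hp, hp, ← integral_sub (hint _) (hint _)]
        congr 1
        funext x₀
        simp only [hHdef]
        rw [intervalIntegral.integral_const_mul, ← mul_sub]
        congr 1
        have hline : ∀ r : ℝ, HasDerivAt (fun r : ℝ => k (x + r • e) x₀)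
            (fderiv ℝ (fun x => k x x₀) (x + r • e) e) r := by
          intro r
          have hd : HasFDerivAt (fun x => k x x₀) (fderiv ℝ (fun x => k x x₀) (x + r • e)) (x + r • e) :=
            ((hk_diff x₀).differentiable (by norm_num) _).hasFDerivAt
          have hl : HasDerivAt (fun r : ℝ => x + r • e) e r := by
            simpa using ((hasDerivAt_id r).smul_const e).const_add x
          exact hd.comp_hasDerivAt r hl
        have hc : Continuous fun r : ℝ => fderiv ℝ (fun x => k x x₀) (x + r • e) e := by
          have := (hk_diff x₀).continuous_fderiv (by norm_num)
          fun_prop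
        rw [intervalIntegral.integral_eq_sub_of_hasDerivAt (fun r _ => hline r)
          (hc.intervalIntegrable _ _)]
        simp
      · refine hx.mono_measure ?_
        rw [Set.uIoc_of_le hh.1.le]
        exact Measure.prod_mono (Measure.restrict_mono (Set.Ioc_subset_Ioc_right hh.2) le_rfl) le_rfl
    have hL := hFi.ae_hasDerivAt_integral
    have hne : ∀ᵐ r : ℝ, r ≠ 1 := by simp [ae_iff, measure_singleton]
    refine (ae_restrict_iff' measurableSet_Ioc).2 ?_
    filter_upwards [hL, hne] with r hr hr1 hrm
    have hr2 := hr (by rw [Set.uIcc_of_le zero_le_one]; exact ⟨hrm.1.le, hrm.2⟩) 0 (by simp)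
    have hd : HasDerivAt (fun h : ℝ => p (x + h • e) - p x) (fderiv ℝ p (x + r • e) e) r := by
      have hl : HasDerivAt (fun r : ℝ => x + r • e) e r := by
        simpa using ((hasDerivAt_id r).smul_const e).const_add x
      exact ((hpd (x + r • e)).hasFDerivAt.comp_hasDerivAt r hl).sub_const _
    refine HasDerivAt.unique (hr2.congr_of_eventuallyEq ?_) hd
    filter_upwards [Ioo_mem_nhds hrm.1 (lt_of_le_of_ne hrm.2 hr1)] with h hh
    exact (hftc h ⟨hh.1, hh.2.le⟩).symm
  have h4 : ∀ᵐ r ∂μ, ∀ᵐ x, F (x + r • e) = fderiv ℝ p (x + r • e) e := by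
    refine (Measure.ae_ae_comm ?_).1 h3
    have : Measurable fun w : Euc n × ℝ => w.1 + w.2 • e := by fun_prop
    exact this hNm
  have : NeZero μ := ⟨by simp [μ, Measure.restrict_eq_zero]⟩
  obtain ⟨r, hr⟩ := h4.exists
  have h5 := (measurePreserving_add_right (volume : Measure (Euc n)) (-(r • e))).quasiMeasurePreserving.ae hr
  filter_upwards [h5] with x hx
  simpa using hx

lemma aux_score {n : ℕ} (f : Euc n → ℝ) (x v : Euc n) (hf : 0 < f x) (hd : DifferentiableAt ℝ f x) :
    f x * inner ℝ (scoreOf f x) v = fderiv ℝ f x v := by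
  have h1 : HasFDerivAt (fun u => Real.log (f u)) ((f x)⁻¹ • fderiv ℝ f x) x :=
    hd.hasFDerivAt.log hf.ne'
  have h2 : inner ℝ (scoreOf f x) v = fderiv ℝ (fun u => Real.log (f u)) x v := by
    rw [← toDual_gradient]
    rfl
  rw [h2, h1.fderiv]
  simp only [FunLike.coe_smul, Pi.smul_apply, smul_eq_mul]
  field_simp

lemma aux_slice {n m : ℕ} (q : Euc n × Euc m → ℝ) (hq_nonneg : ∀ v, 0 ≤ q v)
    (hq_meas : Measurable q) (hq_int : Integrable q) (k : Euc n → Euc n → ℝ)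
    (hk_meas : Measurable fun z : Euc n × Euc n => k z.1 z.2)
    (hk_pos : ∀ x₀ x, 0 < k x x₀)
    (hk_diff : ∀ x₀, ContDiff ℝ 1 fun x => k x x₀)
    (hk_prob : ∀ x₀, ∫ x, k x x₀ = 1)
    (p : Euc n → Euc m → ℝ) (hp : ∀ x y, p x y = ∫ x₀, q (x₀, y) * k x x₀)
    (py : Euc m → ℝ) (pc : Euc n → Euc m → ℝ) (hpc : ∀ x y, p x y = py y * pc x y)
    (hpy : ∀ y, 0 < py y) (hpc_pos : ∀ x y, 0 < pc x y)
    (hpc_diff : ∀ y, Differentiable ℝ fun x => pc x y)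
    (l : ℝ) (hl : 0 < l) (s : Euc n → Euc m → Euc n)
    (h0 : Integrable fun z : (Euc n × Euc m) × Euc n =>
      q z.1 * k z.2 z.1.1 * (l * ‖scoreOf (fun u => k u z.1.1) z.2‖ ^ 2))
    (hD : Integrable fun z : (Euc n × Euc m) × Euc n =>
      q z.1 * k z.2 z.1.1 * (l * (‖scoreOf (fun u => k u z.1.1) z.2 - s z.2 z.1.2‖ ^ 2
        - ‖scoreOf (fun u => k u z.1.1) z.2‖ ^ 2)))
    (hE : Integrable fun w : Euc n × Euc m =>
      p w.1 w.2 * (l * (‖scoreOf (fun u => pc u w.2) w.1 - s w.1 w.2‖ ^ 2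
        - ‖scoreOf (fun u => pc u w.2) w.1‖ ^ 2))) :
    (∫ z : (Euc n × Euc m) × Euc n,
      q z.1 * k z.2 z.1.1 * (l * (‖scoreOf (fun u => k u z.1.1) z.2 - s z.2 z.1.2‖ ^ 2
        - ‖scoreOf (fun u => k u z.1.1) z.2‖ ^ 2))) =
    ∫ w : Euc n × Euc m,
      p w.1 w.2 * (l * (‖scoreOf (fun u => pc u w.2) w.1 - s w.1 w.2‖ ^ 2
        - ‖scoreOf (fun u => pc u w.2) w.1‖ ^ 2)) := by
  have hkd : ∀ x₀ x, DifferentiableAt ℝ (fun x => k x x₀) x :=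
    fun x₀ x => (hk_diff x₀).differentiable (by norm_num) x
  have hp_pos : ∀ x y, 0 < p x y := fun x y => by rw [hpc]; exact mul_pos (hpy y) (hpc_pos x y)
  have hint : ∀ y x, Integrable fun x₀ => q (x₀, y) * k x x₀ := by
    intro y x
    by_contra h
    have := hp_pos x y
    rw [hp, integral_undef h] at this
    exact lt_irrefl _ this
  have hpd : ∀ y, Differentiable ℝ fun x => p x y := by
    intro y
    simp only [hpc]
    exact (hpc_diff y).const_mul _
  -- pointwise identities
  have hDeq : ∀ z : (Euc n × Euc m) × Euc n,
      q z.1 * k z.2 z.1.1 * (l * (‖scoreOf (fun u => k u z.1.1) z.2 - s z.2 z.1.2‖ ^ 2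
        - ‖scoreOf (fun u => k u z.1.1) z.2‖ ^ 2)) =
      l * ‖s z.2 z.1.2‖ ^ 2 * (q z.1 * k z.2 z.1.1)
        - 2 * l * (q z.1 * fderiv ℝ (fun x => k x z.1.1) z.2 (s z.2 z.1.2)) := by
    intro z
    rw [← aux_score (fun x => k x z.1.1) z.2 (s z.2 z.1.2) (hk_pos _ _) (hkd _ _),
      norm_sub_sq_real]
    ring
  have hEeq : ∀ w : Euc n × Euc m,
      p w.1 w.2 * (l * (‖scoreOf (fun u => pc u w.2) w.1 - s w.1 w.2‖ ^ 2
        - ‖scoreOf (fun u => pc u w.2) w.1‖ ^ 2)) =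
      l * ‖s w.1 w.2‖ ^ 2 * p w.1 w.2
        - 2 * l * fderiv ℝ (fun x => p x w.2) w.1 (s w.1 w.2) := by
    intro w
    have h1 : fderiv ℝ (fun x => p x w.2) w.1 (s w.1 w.2)
        = py w.2 * fderiv ℝ (fun x => pc x w.2) w.1 (s w.1 w.2) := by
      simp only [hpc]
      rw [fderiv_const_mul (hpc_diff _ _)]
      rfl
    rw [h1, ← aux_score (fun x => pc x w.2) w.1 (s w.1 w.2) (hpc_pos _ _) (hpc_diff _ _),
      norm_sub_sq_real, hpc]
    ring
  simp only [hDeq] at hD ⊢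
  simp only [hEeq] at hE ⊢
  -- integrability of `q k` and of `q ∂k`
  have hswap : Measurable fun z : (Euc n × Euc m) × Euc n => (z.2, z.1.1) := by fun_prop
  have hqk : Integrable fun z : (Euc n × Euc m) × Euc n => q z.1 * k z.2 z.1.1 := by
    have hm : Measurable fun z : (Euc n × Euc m) × Euc n => q z.1 * k z.2 z.1.1 :=
      (hq_meas.comp measurable_fst).mul (hk_meas.comp hswap)
    have hki : ∀ x₀, Integrable fun x => k x x₀ := by
      intro x₀
      by_contra h
      have := hk_prob x₀
      rw [integral_undef h] at this
      exact zero_ne_one this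
    refine (integrable_prod_iff hm.aestronglyMeasurable).2
      ⟨Filter.Eventually.of_forall fun v => (hki v.1).const_mul (q v), ?_⟩
    have : (fun v : Euc n × Euc m => ∫ x, ‖q v * k x v.1‖) = q := by
      funext v
      have : ∀ x, ‖q v * k x v.1‖ = q v * k x v.1 := fun x =>
        Real.norm_of_nonneg (mul_nonneg (hq_nonneg _) (hk_pos _ _).le)
      simp only [this]
      rw [integral_const_mul, hk_prob, mul_one]
    exact hq_int.congr (Filter.Eventually.of_forall fun v => (congrFun this v).symm)
  have hH : ∀ e : Euc n, Integrable fun z : (Euc n × Euc m) × Euc n =>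
      q z.1 * fderiv ℝ (fun x => k x z.1.1) z.2 e := by
    intro e
    have hm : Measurable fun z : (Euc n × Euc m) × Euc n =>
        q z.1 * fderiv ℝ (fun x => k x z.1.1) z.2 e :=
      (hq_meas.comp measurable_fst).mul ((aux_meas_fderiv k hk_meas hk_diff e).comp hswap)
    refine Integrable.mono' ((h0.const_mul l⁻¹).add (hqk.mul_const (‖e‖ ^ 2)))
      hm.aestronglyMeasurable (Filter.Eventually.of_forall fun z => ?_)
    rw [← aux_score (fun x => k x z.1.1) z.2 e (hk_pos _ _) (hkd _ _)]
    set a := scoreOf (fun x => k x z.1.1) z.2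
    have hqk0 : 0 ≤ q z.1 * k z.2 z.1.1 := mul_nonneg (hq_nonneg _) (hk_pos _ _).le
    rw [← mul_assoc, norm_mul, Real.norm_of_nonneg hqk0]
    have h1 : ‖inner ℝ a e‖ ≤ ‖a‖ * ‖e‖ := norm_inner_le_norm a e
    have h2 : ‖inner ℝ a e‖ ≤ ‖a‖ ^ 2 + ‖e‖ ^ 2 := by
      nlinarith [sq_nonneg (‖a‖ - ‖e‖), sq_nonneg ‖a‖, sq_nonneg ‖e‖]
    calc _ ≤ q z.1 * k z.2 z.1.1 * (‖a‖ ^ 2 + ‖e‖ ^ 2) := mul_le_mul_of_nonneg_left h2 hqk0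
      _ = _ := by
        simp only [Pi.add_apply]
        field_simp
        rfl
  -- reordering of variables
  have mp : MeasurePreserving
      (fun w : Euc m × (Euc n × Euc n) => (((w.2.2, w.1), w.2.1) : (Euc n × Euc m) × Euc n))
      (volume.prod (volume.prod volume)) volume := by
    have a := (MeasurePreserving.id (volume : Measure (Euc m))).prod
      (Measure.measurePreserving_swap (μ := (volume : Measure (Euc n)))
        (ν := (volume : Measure (Euc n))))
    have b := (measurePreserving_prodAssoc (volume : Measure (Euc m))
      (volume : Measure (Euc n)) (volume : Measure (Euc n))).symm
    have c := (Measure.measurePreserving_swap (μ := (volume : Measure (Euc m)))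
        (ν := (volume : Measure (Euc n)))).prod (MeasurePreserving.id (volume : Measure (Euc n)))
    exact c.comp (b.comp a)
  have hD' := mp.integrable_comp_of_integrable hD
  have hDint := integral_map (μ := volume.prod (volume.prod volume)) mp.measurable.aemeasurable
    (mp.map_eq.symm ▸ hD.aestronglyMeasurable)
  rw [mp.map_eq] at hDint
  rw [hDint]
  simp only [Function.comp_def] at hD'
  rw [integral_prod _ hD']
  have hE' : Integrable (fun w : Euc n × Euc m => l * ‖s w.1 w.2‖ ^ 2 * p w.1 w.2
        - 2 * l * fderiv ℝ (fun x => p x w.2) w.1 (s w.1 w.2)) (volume.prod volume) := hE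
  rw [Measure.volume_eq_prod (Euc n) (Euc m), integral_prod_symm _ hE']
  refine integral_congr_ae ?_
  let b := EuclideanSpace.basisFun (Fin n) ℝ
  have hHy : ∀ i, ∀ᵐ y : Euc m, Integrable (fun z : Euc n × Euc n =>
      q (z.2, y) * fderiv ℝ (fun x => k x z.2) z.1 (b i)) (volume.prod volume) := fun i =>
    (mp.integrable_comp_of_integrable (hH (b i))).prod_right_ae
  filter_upwards [hD'.prod_right_ae, ae_all_iff.2 hHy] with y hDy hHy
  rw [integral_prod _ hDy]
  refine integral_congr_ae ?_
  have hkey : ∀ i, ∀ᵐ x, ∫ x₀, q (x₀, y) * fderiv ℝ (fun x => k x x₀) x (b i)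
      = fderiv ℝ (fun x => p x y) x (b i) := fun i =>
    aux_key (fun x₀ => q (x₀, y)) (hq_meas.comp measurable_prodMk_right) k hk_meas hk_diff (b i)
      (hHy i) (hint y) (fun x => p x y) (fun x => hp x y) (hpd y)
  have hHx : ∀ i, ∀ᵐ x, Integrable fun x₀ => q (x₀, y) * fderiv ℝ (fun x => k x x₀) x (b i) :=
    fun i => (hHy i).prod_right_ae
  filter_upwards [ae_all_iff.2 hkey, ae_all_iff.2 hHx] with x hk1 hk2
  have hexp : ∀ L : Euc n →L[ℝ] ℝ, L (s x y) = ∑ i, s x y i * L (b i) := by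
    intro L
    conv_lhs => rw [← b.sum_repr (s x y)]
    simp [b]
  have hsum : ∀ x₀, q (x₀, y) * fderiv ℝ (fun x => k x x₀) x (s x y)
      = ∑ i, s x y i * (q (x₀, y) * fderiv ℝ (fun x => k x x₀) x (b i)) := by
    intro x₀
    rw [hexp, Finset.mul_sum]
    exact Finset.sum_congr rfl fun i _ => by ring
  have hsi : Integrable fun x₀ => q (x₀, y) * fderiv ℝ (fun x => k x x₀) x (s x y) := by
    simp only [hsum]
    exact integrable_finsetSum _ fun i _ => (hk2 i).const_mul _
  have hsint : ∫ x₀, q (x₀, y) * fderiv ℝ (fun x => k x x₀) x (s x y)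
      = fderiv ℝ (fun x => p x y) x (s x y) := by
    simp only [hsum]
    rw [integral_finsetSum _ fun i _ => (hk2 i).const_mul _, hexp]
    refine Finset.sum_congr rfl fun i _ => ?_
    rw [integral_const_mul, hk1]
  show ∫ x₀, (l * ‖s x y‖ ^ 2 * (q (x₀, y) * k x x₀)
    - 2 * l * (q (x₀, y) * fderiv ℝ (fun x => k x x₀) x (s x y))) = _
  rw [integral_sub ((hint y x).const_mul _) (hsi.const_mul _), integral_const_mul,
    integral_const_mul, hsint, ← hp]

/-- equality of the denoising and conditional score matching objectives up to
a constant, and equality of minimizers. -/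
theorem stmt_0 (n m : ℕ) (hn : 1 ≤ n) (hm : 1 ≤ m) (T : ℝ) (hT : 0 < T)
    -- the joint density `q` of `(x₀, y)`
    (q : Euc n × Euc m → ℝ) (hq_nonneg : ∀ v, 0 ≤ q v) (hq_meas : Measurable q)
    (hq_prob : (∫ v : Euc n × Euc m, q v) = 1)
    -- the transition kernel `k t x_t x₀ = k_t(x_t | x₀)`
    (k : ℝ → Euc n → Euc n → ℝ)
    (hk_meas : Measurable fun v : ℝ × Euc n × Euc n => k v.1 v.2.1 v.2.2)
    (hk_pos : ∀ t ∈ Set.Icc (0 : ℝ) T, ∀ x₀ xt, 0 < k t xt x₀)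
    (hk_diff : ∀ t ∈ Set.Icc (0 : ℝ) T, ∀ x₀, ContDiff ℝ 1 fun xt => k t xt x₀)
    (hk_prob : ∀ t ∈ Set.Icc (0 : ℝ) T, ∀ x₀, (∫ xt : Euc n, k t xt x₀) = 1)
    -- the time-`t` joint density of `(x_t, y)` and the marginal of `y`
    (pt : ℝ → Euc n × Euc m → ℝ)
    (hpt : ∀ t xt y, pt t (xt, y) = ∫ x₀ : Euc n, q (x₀, y) * k t xt x₀)
    (py : Euc m → ℝ) (hpy : ∀ y, py y = ∫ x₀ : Euc n, q (x₀, y))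
    -- the conditional density `p_t(x_t | y)`
    (ptc : ℝ → Euc n → Euc m → ℝ)
    (hptc : ∀ t xt y, ptc t xt y = pt t (xt, y) / py y)
    (hptc_pos : ∀ t ∈ Set.Icc (0 : ℝ) T, ∀ xt y, 0 < ptc t xt y)
    (hptc_diff : ∀ t ∈ Set.Icc (0 : ℝ) T, ∀ y, Differentiable ℝ fun xt => ptc t xt y)
    -- the positive weighting function
    (lam : ℝ → ℝ) (hlam_meas : Measurable lam)
    (hlam_pos : ∀ t ∈ Set.Icc (0 : ℝ) T, 0 < lam t)
    -- context finiteness: `E[λ(t)‖∇ ln k_t(x_t|x₀)‖²] < ∞` and `E[λ(t)‖∇ ln p_t(x_t|y)‖²] < ∞`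
    (hfin_k : Integrable (dsmIntegrand n m q k lam fun _ _ _ => 0) (dsmMeas n m T))
    (hfin_p : Integrable (condIntegrand n m pt ptc lam fun _ _ _ => 0) (condMeas n m T)) :
    ∃ C : ℝ,
      (∀ s : Euc n → Euc m → ℝ → Euc n,
        Measurable (fun v : Euc n × Euc m × ℝ => s v.1 v.2.1 v.2.2) →
        Integrable (dsmIntegrand n m q k lam s) (dsmMeas n m T) →
        Integrable (condIntegrand n m pt ptc lam s) (condMeas n m T) →
        LDSM n m T q k lam s = LCOND n m T pt ptc lam s + C)
      ∧ ∀ S : Set (Euc n → Euc m → ℝ → Euc n),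
          (∀ s ∈ S, Measurable (fun v : Euc n × Euc m × ℝ => s v.1 v.2.1 v.2.2) ∧
            Integrable (dsmIntegrand n m q k lam s) (dsmMeas n m T) ∧
            Integrable (condIntegrand n m pt ptc lam s) (condMeas n m T)) →
          ∀ s₀ ∈ S,
            ((∀ s ∈ S, LDSM n m T q k lam s₀ ≤ LDSM n m T q k lam s) ↔
              (∀ s ∈ S, LCOND n m T pt ptc lam s₀ ≤ LCOND n m T pt ptc lam s)) := by
  have hq_int : Integrable q := by
    by_contra h
    rw [integral_undef h] at hq_prob
    exact zero_ne_one hq_prob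
  have hpy_pos : ∀ y, 0 < py y := by
    intro y
    have h0 : 0 ≤ py y := by rw [hpy]; exact integral_nonneg fun _ => hq_nonneg _
    refine lt_of_le_of_ne h0 fun h => ?_
    have := hptc_pos 0 ⟨le_rfl, hT.le⟩ 0 y
    rw [hptc, ← h, div_zero] at this
    exact lt_irrefl _ this
  have main : ∀ s : Euc n → Euc m → ℝ → Euc n,
      Integrable (dsmIntegrand n m q k lam s) (dsmMeas n m T) →
      Integrable (condIntegrand n m pt ptc lam s) (condMeas n m T) →
      (∫ z, dsmIntegrand n m q k lam s z ∂dsmMeas n m T)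
        - (∫ z, dsmIntegrand n m q k lam (fun _ _ _ => 0) z ∂dsmMeas n m T)
      = (∫ w, condIntegrand n m pt ptc lam s w ∂condMeas n m T)
        - ∫ w, condIntegrand n m pt ptc lam (fun _ _ _ => 0) w ∂condMeas n m T := by
    intro s hs1 hs2
    rw [← integral_sub hs1 hfin_k, ← integral_sub hs2 hfin_p]
    have hd := hs1.sub hfin_k
    have hc := hs2.sub hfin_p
    unfold dsmMeas at hd hfin_k ⊢
    unfold condMeas at hc ⊢
    refine (integral_prod _ hd).trans (Eq.trans ?_ (integral_prod _ hc).symm)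
    refine integral_congr_ae ?_
    filter_upwards [hd.prod_right_ae, hc.prod_right_ae, hfin_k.prod_right_ae,
      ae_restrict_mem measurableSet_Ioc] with t hdt hct h0t ht
    have ht' : t ∈ Set.Icc (0:ℝ) T := ⟨ht.1.le, ht.2⟩
    have e1 : (fun z : (Euc n × Euc m) × Euc n => (dsmIntegrand n m q k lam s
        - dsmIntegrand n m q k lam fun _ _ _ => 0) (t, z)) = fun z =>
        q z.1 * k t z.2 z.1.1 * (lam t * (‖scoreOf (fun u => k t u z.1.1) z.2 - s z.2 z.1.2 t‖ ^ 2
        - ‖scoreOf (fun u => k t u z.1.1) z.2‖ ^ 2)) := by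
      funext z
      simp only [Pi.sub_apply, dsmIntegrand, sub_zero]
      ring
    have e2 : (fun w : Euc n × Euc m => (condIntegrand n m pt ptc lam s
        - condIntegrand n m pt ptc lam fun _ _ _ => 0) (t, w)) = fun w =>
        pt t (w.1, w.2) * (lam t * (‖scoreOf (fun u => ptc t u w.2) w.1 - s w.1 w.2 t‖ ^ 2
        - ‖scoreOf (fun u => ptc t u w.2) w.1‖ ^ 2)) := by
      funext w
      simp only [Pi.sub_apply, condIntegrand, sub_zero]
      ring
    have e3 : (fun z : (Euc n × Euc m) × Euc n =>
        (dsmIntegrand n m q k lam fun _ _ _ => 0) (t, z)) = fun z =>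
        q z.1 * k t z.2 z.1.1 * (lam t * ‖scoreOf (fun u => k t u z.1.1) z.2‖ ^ 2) := by
      funext z
      simp only [dsmIntegrand, sub_zero]
    rw [e1] at hdt
    rw [e2] at hct
    rw [e3] at h0t
    refine (congrArg (fun f => ∫ z, f z) e1).trans
      (Eq.trans ?_ (congrArg (fun f => ∫ z, f z) e2).symm)
    have hkm : Measurable fun z : Euc n × Euc n => k t z.1 z.2 :=
      hk_meas.comp (measurable_prodMk_left (x := t))
    exact aux_slice q hq_nonneg hq_meas hq_int (k t) hkm (hk_pos t ht') (hk_diff t ht')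
      (hk_prob t ht') (fun x y => pt t (x, y)) (fun x y => hpt t x y) py (ptc t)
      (fun x y => by rw [hptc, mul_div_cancel₀ _ (hpy_pos y).ne']) hpy_pos (hptc_pos t ht')
      (hptc_diff t ht') (lam t) (hlam_pos t ht') (fun x y => s x y t) h0t hdt hct
  have hC : ∀ s : Euc n → Euc m → ℝ → Euc n,
      Integrable (dsmIntegrand n m q k lam s) (dsmMeas n m T) →
      Integrable (condIntegrand n m pt ptc lam s) (condMeas n m T) →
      LDSM n m T q k lam s = LCOND n m T pt ptc lam s
        + (LDSM n m T q k lam (fun _ _ _ => 0) - LCOND n m T pt ptc lam (fun _ _ _ => 0)) := by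
    intro s h1 h2
    have := main s h1 h2
    unfold LDSM LCOND
    linear_combination (1 / 2) * T⁻¹ * this
  refine ⟨_, fun s _ h1 h2 => hC s h1 h2, fun S hS s₀ hs₀ => ?_⟩
  have h0 := hC s₀ (hS s₀ hs₀).2.1 (hS s₀ hs₀).2.2
  constructor
  · intro h s hs
    have := h s hs
    rw [h0, hC s (hS s hs).2.1 (hS s hs).2.2] at this
    linarith
  · intro h s hs
    have := h s hs
    rw [h0, hC s (hS s hs).2.1 (hS s hs).2.2]
    linarith

end
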